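/- arXiv:2401.09404 — 3 statements merged into one kernel-verified Lean document; each statement's English description precedes it below -/
import Mathlib

section
/- Let s be a positive integer and F ∈ ℤ[x₁,…,x_s]. (i) If for every finite colouring of the positive integers the equation F(x₁,…,x_s) = 0 has a monochromatic solution with the x_i not all equal, then the one-variable polynomial F(x,…,x) ∈ ℤ[x] is intersective, i.e. for every positive integer n there is an integer x with n ∣ F(x,…,x). (ii) If for every finite colouring of the set of primes the equation F(x₁,…,x_s) = 0 has a monochromatic solution in primes with the x_i not all equal, then F(x,…,x) is intersective of the second kind. -/
open Finset

theorem eval_modEq_aux {s : ℕ} (F : MvPolynomial (Fin s) ℤ) (n : ℤ) (x y : Fin s → ℤ)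
    (h : ∀ i, x i ≡ y i [ZMOD n]) :
    MvPolynomial.eval x F ≡ MvPolynomial.eval y F [ZMOD n] := by
  induction F using MvPolynomial.induction_on with
  | C a => simp
  | add p q hp hq => simpa using hp.add hq
  | mul_X p i hp => simpa using hp.mul (h i)

theorem intersectivity_necessary_for_partition_regularity
    (s : ℕ) (hs : 0 < s) (F : MvPolynomial (Fin s) ℤ) :
    -- (i) partition regularity over ℕ forces F(x,…,x) to be intersective
    ((∀ (r : ℕ) (C : ℕ → Fin r), ∃ x : Fin s → ℕ,
        (∀ i, 0 < x i) ∧ (∀ i j, C (x i) = C (x j)) ∧ (∃ i j, x i ≠ x j) ∧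
        MvPolynomial.eval (fun i => ((x i : ℤ))) F = 0) →
      ∀ n : ℕ, 0 < n → ∃ x : ℤ, (n : ℤ) ∣ MvPolynomial.eval (fun _ => x) F) ∧
    -- (ii) partition regularity over the primes forces F(x,…,x) to be intersective
    -- of the second kind
    ((∀ (r : ℕ) (C : ℕ → Fin r), ∃ x : Fin s → ℕ,
        (∀ i, (x i).Prime) ∧ (∀ i j, C (x i) = C (x j)) ∧ (∃ i j, x i ≠ x j) ∧
        MvPolynomial.eval (fun i => ((x i : ℤ))) F = 0) →
      ∀ n : ℕ, 0 < n → ∃ x : ℤ, IsCoprime x (n : ℤ) ∧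
        (n : ℤ) ∣ MvPolynomial.eval (fun _ => x) F) := by
  constructor
  · intro H n hn
    obtain ⟨x, -, hC, -, hF⟩ := H n (fun m => ⟨m % n, Nat.mod_lt _ hn⟩)
    refine ⟨(x ⟨0, hs⟩ : ℤ), ?_⟩
    have h := eval_modEq_aux F n (fun i => (x i : ℤ)) (fun _ => (x ⟨0, hs⟩ : ℤ)) (fun i => by
      have h1 := hC i ⟨0, hs⟩
      simp only [Fin.mk.injEq] at h1
      exact (Int.natCast_modEq_iff).2 h1)
    rw [hF] at h
    exact Int.modEq_zero_iff_dvd.1 h.symm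
  · intro H n hn
    obtain ⟨x, hp, hC, ⟨i, j, hij⟩, hF⟩ := H (2 * n + 1)
      (fun m => ⟨if m ≤ n then m else n + 1 + m % n, by
        have := Nat.mod_lt m hn
        split_ifs <;> omega⟩)
    simp only [Fin.mk.injEq] at hC
    have hbig : ∀ k, n < x k := by
      intro k
      by_contra hk
      have h1 := hC i k
      have h2 := hC j k
      rw [if_pos (not_lt.1 hk)] at h1 h2
      split_ifs at h1 h2 <;> omega
    have hmod : ∀ k l, x k % n = x l % n := by
      intro k l
      have h1 := hC k l
      rw [if_neg (not_le.2 (hbig k)), if_neg (not_le.2 (hbig l))] at h1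
      omega
    refine ⟨(x ⟨0, hs⟩ : ℤ), ?_, ?_⟩
    · rw [Nat.isCoprime_iff_coprime]
      exact ((hp _).coprime_iff_not_dvd).2
        (fun hd => absurd (Nat.le_of_dvd hn hd) (not_le.2 (hbig _)))
    · have h := eval_modEq_aux F n (fun i => (x i : ℤ)) (fun _ => (x ⟨0, hs⟩ : ℤ)) (fun i =>
        (Int.natCast_modEq_iff).2 (hmod i ⟨0, hs⟩))
      rw [hF] at h
      exact Int.modEq_zero_iff_dvd.1 h.symm
end

section
/- Let s be a positive integer and F ∈ ℤ[x₁,…,x_s]. If the equation F(x₁,…,x_s) = 0 has, in every set A of positive integers with limsup_{N→∞} |A∩[N]|/N > 0, a solution with the x_i not all equal, or has, in every set A of primes with limsup_{N→∞} |A∩[N]|/|𝒫∩[N]| > 0, a solution with the x_i not all equal, then the one-variable polynomial F(x,…,x) ∈ ℤ[x] is the zero polynomial. -/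
open Finset Filter

section aux
open ArithmeticFunction ArithmeticFunction.vonMangoldt

/-- Upper bound companion of `LSeries_residueClass_lower_bound`. -/
lemma residueClass_upper_bound {q : ℕ} [NeZero q] {a : ZMod q} (ha : IsUnit a) :
    ∃ C : ℝ, ∀ {x : ℝ} (_ : x ∈ Set.Ioc 1 2),
      ∑' n, residueClass a n / (n : ℝ) ^ x ≤ (q.totient : ℝ)⁻¹ / (x - 1) + C := by
  have H {x : ℝ} (hx : 1 < x) :
      ∑' n, residueClass a n / (n : ℝ) ^ x =
        (LFunctionResidueClassAux a x).re + (q.totient : ℝ)⁻¹ / (x - 1) := by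
    refine Complex.ofReal_injective ?_
    simp only [Complex.ofReal_tsum, Complex.ofReal_div, Complex.ofReal_cpow (Nat.cast_nonneg _),
      Complex.ofReal_natCast,
      Complex.ofReal_add, Complex.ofReal_inv, Complex.ofReal_sub, Complex.ofReal_one]
    simp_rw [← LFunctionResidueClassAux_real ha hx,
      eqOn_LFunctionResidueClassAux ha <| Set.mem_ofPred.mpr (Complex.ofReal_re x ▸ hx),
      sub_add_cancel, LSeries, LSeries.term]
    refine tsum_congr fun n ↦ ?_
    split_ifs with hn
    · simp only [hn, residueClass_apply_zero, Complex.ofReal_zero, zero_div]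
    · rfl
  have : ContinuousOn (fun x : ℝ ↦ (LFunctionResidueClassAux a x).re) (Set.Icc 1 2) :=
    Complex.continuous_re.continuousOn.comp (t := Set.univ)
      (continuousOn_LFunctionResidueClassAux a)
      (fun ⦃x⦄ a ↦ trivial) |>.comp Complex.continuous_ofReal.continuousOn fun x hx ↦ by
        simpa only [Set.mem_ofPred_eq, Complex.ofReal_re] using hx.1
  obtain ⟨C, hC⟩ := bddAbove_def.mp <| IsCompact.bddAbove_image isCompact_Icc this
  refine ⟨C, fun {x} hx ↦ ?_⟩
  rw [H hx.1, add_comm, add_le_add_iff_left]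
  exact hC _ (Set.mem_image_of_mem (fun x : ℝ ↦ (LFunctionResidueClassAux a x).re)
    (Set.mem_Icc_of_Ioc hx))

lemma summable_residueClass_rpow {q : ℕ} (a : ZMod q) {x : ℝ} (hx : 1 < x) :
    Summable fun n : ℕ => residueClass a n / (n : ℝ) ^ x :=
  LSeries.summable_real_of_abscissaOfAbsConv_lt <|
        (abscissaOfAbsConv_residueClass_le_one a).trans_lt <| mod_cast hx

/-- The sum over primes in a residue class, weight `log p / p ^ x`. -/
noncomputable def primeTerm {q : ℕ} (a : ZMod q) (x : ℝ) (n : ℕ) : ℝ :=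
  (if n.Prime then residueClass a n else 0) / (n : ℝ) ^ x

lemma primeTerm_nonneg {q : ℕ} (a : ZMod q) (x : ℝ) (n : ℕ) : 0 ≤ primeTerm a x n := by
  unfold primeTerm
  have := residueClass_nonneg a n
  split_ifs <;> positivity

lemma primeTerm_le {q : ℕ} (a : ZMod q) (x : ℝ) (n : ℕ) :
    primeTerm a x n ≤ residueClass a n / (n : ℝ) ^ x := by
  unfold primeTerm
  have := residueClass_nonneg a n
  gcongr
  split_ifs <;> linarith

lemma summable_primeTerm {q : ℕ} (a : ZMod q) {x : ℝ} (hx : 1 < x) :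
    Summable (primeTerm a x) :=
  (summable_residueClass_rpow a hx).of_nonneg_of_le (primeTerm_nonneg a x) (primeTerm_le a x)

lemma primeTerm_upper {q : ℕ} [NeZero q] {a : ZMod q} (ha : IsUnit a) :
    ∃ C : ℝ, ∀ {x : ℝ} (_ : x ∈ Set.Ioc 1 2),
      ∑' n, primeTerm a x n ≤ (q.totient : ℝ)⁻¹ / (x - 1) + C := by
  obtain ⟨C, hC⟩ := residueClass_upper_bound ha
  exact ⟨C, fun {x} hx => le_trans ((summable_primeTerm a hx.1).tsum_le_tsum (primeTerm_le a x)
    (summable_residueClass_rpow a hx.1)) (hC hx)⟩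

lemma primeTerm_lower {q : ℕ} [NeZero q] {a : ZMod q} (ha : IsUnit a) :
    ∃ C : ℝ, ∀ {x : ℝ} (_ : x ∈ Set.Ioc 1 2),
      (q.totient : ℝ)⁻¹ / (x - 1) - C ≤ ∑' n, primeTerm a x n := by
  obtain ⟨C, hC⟩ := LSeries_residueClass_lower_bound ha
  have hs := summable_residueClass_non_primes_div a
  refine ⟨C + ∑' n : ℕ, (if n.Prime then 0 else residueClass a n) / (n : ℝ), fun {x} hx => ?_⟩
  have h1 := hC hx
  have h2 : ∑' n : ℕ, residueClass a n / (n : ℝ) ^ x ≤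
      ∑' n : ℕ, (primeTerm a x n + (if n.Prime then 0 else residueClass a n) / (n : ℝ)) := by
    refine (summable_residueClass_rpow a hx.1).tsum_le_tsum (fun n => ?_)
      ((summable_primeTerm a hx.1).add hs)
    unfold primeTerm
    by_cases hp : n.Prime
    · simp [hp]
    · simp only [hp, if_false, zero_div, zero_add]
      rcases n.eq_zero_or_pos with rfl | hn
      · simp
      · refine div_le_div_of_nonneg_left (residueClass_nonneg a _) (mod_cast hn) ?_
        conv_lhs => rw [← Real.rpow_one n]
        exact Real.rpow_le_rpow_of_exponent_le (by norm_cast) hx.1.le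
  rw [(summable_primeTerm a hx.1).tsum_add hs] at h2
  linarith

lemma abel_aux (c w : ℕ → ℝ) (N₀ : ℕ) (K : ℝ)
    (hS : ∀ N ≥ N₀, 0 ≤ ∑ n ∈ range (N + 1), c n)
    (hw : ∀ n ≥ N₀, w (n + 1) ≤ w n)
    (hK : -K ≤ ∑ n ∈ range (N₀ + 1), c n * (w n - w N₀)) (M : ℕ) (hM : N₀ ≤ M) :
    -K + (∑ n ∈ range (M + 1), c n) * w M ≤ ∑ n ∈ range (M + 1), c n * w n := by
  induction M, hM using Nat.le_induction with
  | base =>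
    simp only [mul_sub, Finset.sum_sub_distrib, ← Finset.sum_mul] at hK
    linarith
  | succ M hM ih =>
    rw [Finset.sum_range_succ _ (M + 1), Finset.sum_range_succ _ (M + 1)]
    nlinarith [mul_le_mul_of_nonneg_left (hw M hM) (hS M hM)]

lemma weight_antitone {x : ℝ} (hx : 1 < x) (n : ℕ) (hn : 3 ≤ n) :
    Real.log ((n + 1 : ℕ) : ℝ) / ((n + 1 : ℕ) : ℝ) ^ x ≤ Real.log n / (n : ℝ) ^ x := by
  have h3 : Real.exp x⁻¹ ≤ 3 := by
    have : Real.exp x⁻¹ ≤ Real.exp 1 := Real.exp_le_exp.2 (inv_le_one_of_one_le₀ hx.le)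
    linarith [Real.exp_one_lt_d9]
  have hn' : (3 : ℝ) ≤ n := by exact_mod_cast hn
  apply Real.log_div_self_rpow_antitoneOn (by linarith : 0 < x)
  · exact h3.trans hn'
  · simp only [Set.mem_Ici]; push_cast; linarith
  · push_cast; linarith

lemma weight_bound {x : ℝ} (hx : 1 < x) (n : ℕ) :
    0 ≤ Real.log (n : ℝ) / (n : ℝ) ^ x ∧ Real.log (n : ℝ) / (n : ℝ) ^ x ≤ n := by
  have h0 : 0 ≤ Real.log (n : ℝ) := Real.log_natCast_nonneg n
  refine ⟨by positivity, ?_⟩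
  rcases n.eq_zero_or_pos with rfl | hn
  · simp
  · have h1 : (1 : ℝ) ≤ n := by exact_mod_cast hn
    have h2 : 1 ≤ (n : ℝ) ^ x := Real.one_le_rpow h1 (by linarith)
    exact (div_le_self h0 h2).trans (Real.log_le_self (by linarith))

lemma primeTerm_eq {q : ℕ} (a : ZMod q) [DecidablePred fun n : ℕ => n.Prime ∧ (n : ZMod q) = a]
    (x : ℝ) (n : ℕ) :
    primeTerm a x n = (if n.Prime ∧ (n : ZMod q) = a then 1 else 0) *
      (Real.log n / (n : ℝ) ^ x) := by
  unfold primeTerm residueClass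
  by_cases hp : n.Prime
  · by_cases h : (n : ZMod q) = a
    · simp [hp, h, Set.indicator, vonMangoldt_apply_prime hp]
    · simp [hp, h, Set.indicator]
  · simp [hp]

open scoped Classical in
/-- Counting: primes in an invertible class cannot have relative density zero. -/
lemma not_eventually_small {q : ℕ} [NeZero q] {a : ZMod q} (ha : IsUnit a) (N₀ : ℕ)
    (h : ∀ N ≥ N₀, ∑ n ∈ range (N + 1), (if n.Prime ∧ (n : ZMod q) = a then (1 : ℝ) else 0) ≤
      ((q.totient : ℝ)⁻¹ / 2) *
        ∑ n ∈ range (N + 1), (if n.Prime then (1 : ℝ) else 0)) : False := by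
  wlog h3 : 3 ≤ N₀ generalizing N₀
  · exact this (N₀ + 3) (fun N hN => h N (by omega)) (by omega)
  set ε : ℝ := (q.totient : ℝ)⁻¹ / 2 with hε
  have hq : 0 < (q.totient : ℝ)⁻¹ := inv_pos.mpr (mod_cast Nat.totient_pos.2 (NeZero.pos q))
  have hε0 : 0 < ε := by positivity
  obtain ⟨C₁, hC₁⟩ := primeTerm_lower ha
  obtain ⟨C₂, hC₂⟩ := primeTerm_upper (q := 1) (a := 1) isUnit_one
  let c : ℕ → ℝ := fun n => ε * (if n.Prime ∧ (n : ZMod 1) = 1 then 1 else 0) -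
    (if n.Prime ∧ (n : ZMod q) = a then 1 else 0)
  have hc : ∀ n, |c n| ≤ ε + 1 := by
    intro n
    simp only [c]
    rw [abs_le]
    split_ifs <;> constructor <;> linarith
  have hS : ∀ N ≥ N₀, 0 ≤ ∑ n ∈ range (N + 1), c n := by
    intro N hN
    have := h N hN
    simp only [c, Finset.sum_sub_distrib, ← Finset.mul_sum]
    have e : ∀ n : ℕ, (n.Prime ∧ (n : ZMod 1) = 1) ↔ n.Prime :=
      fun n => ⟨fun h => h.1, fun h => ⟨h, Subsingleton.elim _ _⟩⟩
    simp only [e]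
    linarith
  let K : ℝ := ∑ n ∈ range (N₀ + 1), (ε + 1) * N₀
  have key : ∀ x ∈ Set.Ioc (1 : ℝ) 2, ε / (x - 1) ≤ K + C₁ + ε * C₂ := by
    intro x hx
    let w : ℕ → ℝ := fun n => Real.log n / (n : ℝ) ^ x
    have hK : -K ≤ ∑ n ∈ range (N₀ + 1), c n * (w n - w N₀) := by
      rw [← Finset.sum_neg_distrib]
      refine Finset.sum_le_sum fun n hn => ?_
      have hn' : (n : ℝ) ≤ N₀ := by exact_mod_cast Nat.lt_succ_iff.1 (Finset.mem_range.1 hn)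
      obtain ⟨a1, a2⟩ := weight_bound hx.1 n
      obtain ⟨b1, b2⟩ := weight_bound hx.1 N₀
      have hw : |w n - w N₀| ≤ N₀ := by
        rw [abs_le]; constructor <;> simp only [w] <;> linarith
      have := mul_le_mul (hc n) hw (abs_nonneg _) (by linarith)
      rw [← abs_mul] at this
      linarith [neg_abs_le (c n * (w n - w N₀))]
    have hpart := abel_aux c w N₀ K hS
      (fun n hn => weight_antitone hx.1 n (h3.trans hn)) hK
    have hcw : ∀ n, c n * w n = ε * primeTerm (1 : ZMod 1) x n - primeTerm a x n := by
      intro n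
      rw [primeTerm_eq, primeTerm_eq]
      simp only [c, w]
      ring
    have s1 := (summable_primeTerm (1 : ZMod 1) hx.1).mul_left ε
    have s2 := summable_primeTerm a hx.1
    have ht := (s1.sub s2).hasSum.tendsto_sum_nat
    have hlim : -K ≤ ∑' n, (ε * primeTerm (1 : ZMod 1) x n - primeTerm a x n) := by
      refine ge_of_tendsto ht ?_
      filter_upwards [eventually_ge_atTop (N₀ + 1)] with M hM
      obtain ⟨M, rfl⟩ : ∃ M', M = M' + 1 := ⟨M - 1, by omega⟩
      have h1 := hpart M (by omega)
      have h2 := mul_nonneg (hS M (by omega)) (weight_bound hx.1 M).1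
      simp only [← hcw]
      simp only [w] at h1 h2 ⊢
      linarith
    rw [s1.tsum_sub s2, tsum_mul_left] at hlim
    have l1 := hC₁ hx
    have l2 := mul_le_mul_of_nonneg_left (hC₂ hx) hε0.le
    have e1 : (q.totient : ℝ)⁻¹ / (x - 1) = 2 * (ε / (x - 1)) := by rw [hε]; ring
    have e2 : ε * (((Nat.totient 1 : ℕ) : ℝ)⁻¹ / (x - 1) + C₂) = ε / (x - 1) + ε * C₂ := by
      simp; ring
    rw [e1] at l1
    rw [e2] at l2
    linarith
  set B := K + C₁ + ε * C₂
  have hB : 0 < B := by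
    have := key 2 ⟨by norm_num, le_rfl⟩
    norm_num at this
    linarith
  set t := min 1 (ε / (2 * B)) with ht
  have ht0 : 0 < t := lt_min one_pos (by positivity)
  have h4 := key (1 + t) ⟨by linarith, by linarith [min_le_left 1 (ε / (2 * B))]⟩
  rw [add_sub_cancel_left, div_le_iff₀ ht0] at h4
  have h5 : B * t ≤ B * (ε / (2 * B)) := by gcongr; exact min_le_right _ _
  have h6 : B * (ε / (2 * B)) = ε / 2 := by field_simp
  linarith

lemma card_eq_sum (p : ℕ → Prop) [DecidablePred p] (N : ℕ) (S : Set ℕ) (hS : ∀ n, n ∈ S ↔ n ≤ N ∧ p n) :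
    (Nat.card S : ℝ) = ∑ n ∈ range (N + 1), (if p n then (1 : ℝ) else 0) := by
  have : S = ((range (N + 1)).filter p : Finset ℕ) := by
    ext n; simp [hS]
  rw [this, Nat.card_coe_set_eq, Set.ncard_coe_finset, Finset.sum_boole]

lemma primes_density_pos {q : ℕ} [NeZero q] {a : ZMod q} (ha : IsUnit a) :
    0 < Filter.limsup (fun N : ℕ =>
            (Nat.card ({p : ℕ | p.Prime ∧ (p : ZMod q) = a} ∩ Set.Icc 1 N : Set ℕ) : ℝ) /
              (Nat.card {p : ℕ | p.Prime ∧ p ≤ N} : ℝ)) Filter.atTop := by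
  classical
  have hq : 0 < (q.totient : ℝ)⁻¹ := inv_pos.mpr (mod_cast Nat.totient_pos.2 (NeZero.pos q))
  have c1 : ∀ N, (Nat.card ({p : ℕ | p.Prime ∧ (p : ZMod q) = a} ∩ Set.Icc 1 N : Set ℕ) : ℝ) =
      ∑ n ∈ range (N + 1), (if n.Prime ∧ (n : ZMod q) = a then (1 : ℝ) else 0) := by
    intro N
    refine card_eq_sum (fun n : ℕ => n.Prime ∧ (n : ZMod q) = a) N _ fun n => ?_
    simp only [Set.mem_inter_iff, Set.mem_ofPred_eq, Set.mem_Icc]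
    constructor
    · rintro ⟨h, -, h'⟩; exact ⟨h', h⟩
    · rintro ⟨h', h⟩; exact ⟨h, h.1.one_le, h'⟩
  have c2 : ∀ N, (Nat.card {p : ℕ | p.Prime ∧ p ≤ N} : ℝ) =
      ∑ n ∈ range (N + 1), (if n.Prime then (1 : ℝ) else 0) := by
    intro N
    refine card_eq_sum Nat.Prime N {p : ℕ | p.Prime ∧ p ≤ N} fun n => ?_
    simp only [Set.mem_ofPred_eq, and_comm]
  simp only [c1, c2]
  have hle : ∀ N, ∑ n ∈ range (N + 1), (if n.Prime ∧ (n : ZMod q) = a then (1 : ℝ) else 0) ≤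
      ∑ n ∈ range (N + 1), (if n.Prime then (1 : ℝ) else 0) := by
    intro N
    refine Finset.sum_le_sum fun n _ => ?_
    by_cases h : n.Prime
    · simp only [h, true_and, if_true]; split_ifs <;> norm_num
    · simp [h]
  have hnn : ∀ N, 0 ≤ ∑ n ∈ range (N + 1), (if n.Prime then (1 : ℝ) else 0) :=
    fun N => Finset.sum_nonneg fun n _ => by split_ifs <;> norm_num
  by_contra hcon
  have hlt := lt_of_le_of_lt (not_lt.1 hcon) (half_pos hq)
  have hev := eventually_lt_of_limsup_lt hlt
    (isBoundedUnder_of ⟨1, fun N => div_le_one_of_le₀ (hle N) (hnn N)⟩)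
  obtain ⟨N₀, hN₀⟩ := eventually_atTop.1 hev
  refine not_eventually_small ha N₀ fun N hN => ?_
  have h1 := hN₀ N hN
  rcases (hnn N).eq_or_lt with h0 | h0
  · have := hle N
    rw [← h0] at this ⊢
    simpa using this
  · rw [div_lt_iff₀ h0] at h1
    exact h1.le

lemma nat_density_pos {q b : ℕ} (hb : 0 < b) (hbq : b < q) :
    0 < Filter.limsup (fun N : ℕ =>
            (Nat.card ({n : ℕ | 0 < n ∧ (n : ZMod q) = b} ∩ Set.Icc 1 N : Set ℕ) : ℝ) /
              (N : ℝ)) Filter.atTop := by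
  have hq : (0 : ℝ) < q := by exact_mod_cast hb.trans hbq
  have hcard : ∀ N, Nat.card ({n : ℕ | 0 < n ∧ (n : ZMod q) = b} ∩ Set.Icc 1 N : Set ℕ) ≤ N := by
    intro N
    have := Set.ncard_le_ncard (s := {n : ℕ | 0 < n ∧ (n : ZMod q) = b} ∩ Set.Icc 1 N)
      Set.inter_subset_right (Set.finite_Icc 1 N)
    rw [Nat.card_coe_set_eq]
    refine this.trans ?_
    rw [← Finset.coe_Icc, Set.ncard_coe_finset]; simp
  by_contra hcon
  have hlt := lt_of_le_of_lt (not_lt.1 hcon) (half_pos (inv_pos.2 hq))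
  have hev := eventually_lt_of_limsup_lt hlt
    (isBoundedUnder_of ⟨1, fun N => div_le_one_of_le₀ (by exact_mod_cast hcard N)
      (Nat.cast_nonneg N)⟩)
  obtain ⟨N₀, hN₀⟩ := eventually_atTop.1 hev
  have h1 := hN₀ (q * (N₀ + 1)) (by nlinarith)
  have h2 : N₀ + 1 ≤ Nat.card ({n : ℕ | 0 < n ∧ (n : ZMod q) = b} ∩
      Set.Icc 1 (q * (N₀ + 1)) : Set ℕ) := by
    have hsub : (((range (N₀ + 1)).image fun j => b + q * j : Finset ℕ) : Set ℕ) ⊆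
        {n : ℕ | 0 < n ∧ (n : ZMod q) = b} ∩ Set.Icc 1 (q * (N₀ + 1)) := by
      intro n hn
      simp only [Finset.coe_image, Set.mem_image, Finset.mem_coe, Finset.mem_range] at hn
      obtain ⟨j, hj, rfl⟩ := hn
      refine ⟨⟨by omega, by simp⟩, by omega, ?_⟩
      nlinarith
    have := Set.ncard_le_ncard hsub ((Set.finite_Icc _ _).inter_of_right _)
    rw [Set.ncard_coe_finset, Finset.card_image_of_injective, Finset.card_range] at this
    · rwa [Nat.card_coe_set_eq]
    · intro i j hij
      have : q * i = q * j := by simpa using hij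
      exact Nat.eq_of_mul_eq_mul_left (hb.trans hbq) this
  have h2' : ((N₀ + 1 : ℕ) : ℝ) ≤ _ := Nat.cast_le.2 h2
  have h3 : (0 : ℝ) < ((N₀ + 1 : ℕ) : ℝ) := by positivity
  rw [div_lt_iff₀ (by push_cast at h3 ⊢; positivity)] at h1
  have h4 : (q : ℝ)⁻¹ / 2 * ((q * (N₀ + 1) : ℕ) : ℝ) = ((N₀ + 1 : ℕ) : ℝ) / 2 := by
    push_cast; field_simp
  rw [h4] at h1
  linarith

lemma eval_cast_congr {s : ℕ} (F : MvPolynomial (Fin s) ℤ) {q : ℕ} (x y : Fin s → ℤ)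
    (h : ∀ i, (x i : ZMod q) = y i) :
    ((MvPolynomial.eval x F : ℤ) : ZMod q) = (MvPolynomial.eval y F : ℤ) := by
  simp only [MvPolynomial.eval_eq', Int.cast_sum, Int.cast_mul, Int.cast_prod, Int.cast_pow, h]

end aux

theorem density_regularity_forces_zero_polynomial
    (s : ℕ) (hs : 0 < s) (F : MvPolynomial (Fin s) ℤ) :
    -- density regularity over ℕ, or over the primes, forces F(x,…,x) ≡ 0
    ((∀ A : Set ℕ, (∀ n ∈ A, 0 < n) →
        0 < Filter.limsup (fun N : ℕ =>
            (Nat.card (A ∩ Set.Icc 1 N : Set ℕ) : ℝ) / (N : ℝ)) Filter.atTop →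
        ∃ x : Fin s → ℕ, (∀ i, x i ∈ A) ∧ (∃ i j, x i ≠ x j) ∧
          MvPolynomial.eval (fun i => ((x i : ℤ))) F = 0) ∨
      (∀ A : Set ℕ, (∀ n ∈ A, n.Prime) →
        0 < Filter.limsup (fun N : ℕ =>
            (Nat.card (A ∩ Set.Icc 1 N : Set ℕ) : ℝ) /
              (Nat.card {p : ℕ | p.Prime ∧ p ≤ N} : ℝ)) Filter.atTop →
        ∃ x : Fin s → ℕ, (∀ i, x i ∈ A) ∧ (∃ i j, x i ≠ x j) ∧
          MvPolynomial.eval (fun i => ((x i : ℤ))) F = 0)) →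
    MvPolynomial.aeval (fun _ : Fin s => (Polynomial.X : Polynomial ℤ)) F = 0 := by
  classical
  intro H
  by_contra hP
  set P : Polynomial ℤ := MvPolynomial.aeval (fun _ : Fin s => (Polynomial.X : Polynomial ℤ)) F
    with hPdef
  obtain ⟨b, hb0, hb⟩ : ∃ b : ℕ, 0 < b ∧ P.eval (b : ℤ) ≠ 0 := by
    by_contra! hcon
    apply hP
    refine Polynomial.eq_zero_of_infinite_isRoot P ?_
    refine Set.infinite_of_injective_forall_mem (f := fun n : ℕ => ((n + 1 : ℕ) : ℤ)) ?_ ?_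
    · intro i j hij
      simpa using hij
    · intro n
      exact hcon (n + 1) (Nat.succ_pos n)
  have hbF : MvPolynomial.eval (fun _ : Fin s => (b : ℤ)) F = P.eval (b : ℤ) := by
    rw [hPdef, MvPolynomial.aeval_def, MvPolynomial.eval₂_eq', MvPolynomial.eval_eq',
      Polynomial.eval_finset_sum]
    simp [Polynomial.eval_prod]
  obtain ⟨q, hqge, hq⟩ := Nat.exists_infinite_primes (b + (P.eval (b : ℤ)).natAbs + 1)
  haveI : Fact q.Prime := ⟨hq⟩
  have hfin : ∀ x : Fin s → ℕ, (∀ i, ((x i : ℕ) : ZMod q) = b) →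
      MvPolynomial.eval (fun i => ((x i : ℤ))) F ≠ 0 := by
    intro x hx h0
    have h1 := eval_cast_congr F (q := q) (fun i => (x i : ℤ)) (fun _ => (b : ℤ))
      (fun i => by simpa using hx i)
    rw [h0, hbF, Int.cast_zero, eq_comm, ZMod.intCast_zmod_eq_zero_iff_dvd] at h1
    have h2 := Nat.le_of_dvd (Int.natAbs_pos.2 hb) (Int.natCast_dvd.1 h1)
    omega
  rcases H with H | H
  · obtain ⟨x, hx, -, h0⟩ := H {n : ℕ | 0 < n ∧ (n : ZMod q) = b} (fun n hn => hn.1)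
      (nat_density_pos hb0 (by omega))
    exact hfin x (fun i => (hx i).2) h0
  · have hu : IsUnit (b : ZMod q) := by
      rw [isUnit_iff_ne_zero, Ne, ZMod.natCast_eq_zero_iff]
      intro hd
      have := Nat.le_of_dvd hb0 hd
      omega
    obtain ⟨x, hx, -, h0⟩ := H {n : ℕ | n.Prime ∧ (n : ZMod q) = b} (fun n hn => hn.1)
      (primes_density_pos hu)
    exact hfin x (fun i => (hx i).2) h0
end

section
/- Let s be a positive integer, let h be an integer polynomial of positive degree, let a₁,…,a_s be non-zero integers, and let b be an integer. If the equation a₁h(x₁)+⋯+a_sh(x_s) = b has, in every set A of positive integers with limsup_{N→∞} |A∩[N]|/N > 0, a solution with the x_i not all equal, or has, in every set A of primes with limsup_{N→∞} |A∩[N]|/|𝒫∩[N]| > 0, a solution with the x_i not all equal, then b = a₁+⋯+a_s = 0. -/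
open Finset Filter

open ArithmeticFunction vonMangoldt in
/-- The Dirichlet series of the von Mangoldt function on a coprime class has residue `1/φ(q)`. -/
lemma aux_residue {q : ℕ} [NeZero q] {r : ZMod q} (hr : IsUnit r) :
    Tendsto (fun s : ℝ => ((s : ℂ) - 1) * LSeries (fun n => (residueClass r n : ℂ)) s)
      (nhdsWithin 1 (Set.Ioi 1)) (nhds ((q.totient : ℂ)⁻¹)) := by
  have h1 : Tendsto (fun s : ℝ => LFunctionResidueClassAux r (s : ℂ))
      (nhdsWithin 1 (Set.Ioi 1)) (nhds (LFunctionResidueClassAux r ((1 : ℝ) : ℂ))) := by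
    have hc := continuousOn_LFunctionResidueClassAux r ((1 : ℝ) : ℂ) (by simp)
    refine Tendsto.comp (g := LFunctionResidueClassAux r) hc ?_
    refine tendsto_nhdsWithin_iff.mpr ⟨?_, ?_⟩
    · exact (Complex.continuous_ofReal.tendsto 1).mono_left nhdsWithin_le_nhds
    · filter_upwards [self_mem_nhdsWithin] with s hs
      simpa using (le_of_lt hs)
  have h2 : Tendsto (fun s : ℝ => ((s : ℂ) - 1)) (nhdsWithin 1 (Set.Ioi 1)) (nhds 0) := by
    have : Tendsto (fun s : ℝ => ((s : ℂ) - 1)) (nhds 1) (nhds (((1 : ℝ) : ℂ) - 1)) :=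
      Continuous.tendsto (by fun_prop) 1
    simpa using this.mono_left nhdsWithin_le_nhds
  have h3 := (h2.mul h1).add_const ((q.totient : ℂ)⁻¹)
  rw [zero_mul, zero_add] at h3
  refine h3.congr' ?_
  filter_upwards [self_mem_nhdsWithin] with s hs
  have hs' : (1 : ℝ) < s := hs
  rw [eqOn_LFunctionResidueClassAux hr (by simpa using hs')]
  have : (s : ℂ) - 1 ≠ 0 := by
    rw [sub_ne_zero]; exact_mod_cast hs'.ne'
  field_simp
  ring

open ArithmeticFunction vonMangoldt in
lemma aux_not_tendsto {q : ℕ} [NeZero q] {r : ZMod q} (hr : IsUnit r) :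
    ¬ Tendsto (fun N : ℕ => (∑ k ∈ Icc 1 N, residueClass r k) / (N : ℝ)) atTop (nhds 0) := by
  intro H
  have h1 := LSeries_tendsto_sub_mul_nhds_one_of_tendsto_sum_div_and_nonneg _ H
    (residueClass_nonneg r)
  have h2 := tendsto_nhds_unique h1 (aux_residue hr)
  have : (q.totient : ℂ) ≠ 0 := by
    exact_mod_cast (Nat.totient_pos.mpr (NeZero.pos q)).ne'
  simp only [Complex.ofReal_zero] at h2
  exact inv_ne_zero this h2.symm

open ArithmeticFunction vonMangoldt in
lemma aux_sum_le {q : ℕ} (r : ZMod q) (N : ℕ) :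
    ∑ k ∈ Icc 1 N, residueClass r k ≤
      (Nat.card ({p : ℕ | p.Prime ∧ (p : ZMod q) = r} ∩ Set.Icc 1 N : Set ℕ) : ℝ) * Real.log N
        + (Chebyshev.psi N - Chebyshev.theta N) := by
  classical
  rw [Chebyshev.psi_sub_theta_eq_sum_not_prime, Nat.floor_natCast]
  rw [← Finset.sum_filter_add_sum_filter_not (Icc 1 N) Nat.Prime]
  refine add_le_add ?_ ?_
  · have hset : ({p : ℕ | p.Prime ∧ (p : ZMod q) = r} ∩ Set.Icc 1 N : Set ℕ) =
        ((Icc 1 N).filter (fun p => p.Prime ∧ (p : ZMod q) = r) : Finset ℕ) := by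
      ext p; simp [and_comm]
    rw [hset, Nat.card_coe_set_eq, Set.ncard_coe_finset, ← nsmul_eq_mul, ← Finset.sum_const]
    rw [← Finset.filter_filter, Finset.sum_filter (fun p : ℕ => (p : ZMod q) = r)]
    refine Finset.sum_le_sum fun p hp => ?_
    simp only [mem_filter, mem_Icc] at hp
    simp only [residueClass, Set.indicator_apply, Set.mem_ofPred_eq]
    split_ifs
    · rw [vonMangoldt_apply_prime hp.2]
      exact Real.log_le_log (by exact_mod_cast hp.1.1) (by exact_mod_cast hp.1.2)
    · exact le_rfl
  · exact Finset.sum_le_sum fun n _ => residueClass_le r n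

open ArithmeticFunction vonMangoldt in
lemma aux_primes_not_tendsto {q : ℕ} [NeZero q] {r : ZMod q} (hr : IsUnit r) :
    ¬ Tendsto (fun N : ℕ =>
      (Nat.card ({p : ℕ | p.Prime ∧ (p : ZMod q) = r} ∩ Set.Icc 1 N : Set ℕ) : ℝ) /
              (Nat.card {p : ℕ | p.Prime ∧ p ≤ N} : ℝ)) atTop (nhds 0) := by
  intro H
  apply aux_not_tendsto hr
  obtain ⟨C, hC⟩ := Chebyshev.psi_sub_theta_le_mul_sqrt
  have hpi : ∀ N : ℕ, Nat.card {p : ℕ | p.Prime ∧ p ≤ N} = Nat.primeCounting N := by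
    intro N
    rw [← Nat.primesLE_card_eq_primeCounting, ← Fintype.card_coe, ← Nat.card_eq_fintype_card]
    congr 1
    refine congrArg _ ?_
    ext p
    simp [Nat.mem_primesLE, and_comm]
  have hcheb := (Chebyshev.eventually_primeCounting_le (ε := 1) one_pos)
  have hcheb' := tendsto_natCast_atTop_atTop (R := ℝ) |>.eventually hcheb
  have hsq : Tendsto (fun N : ℕ => C * (√(N : ℝ))⁻¹) atTop (nhds 0) := by
    have : Tendsto (fun N : ℕ => √(N : ℝ)) atTop atTop :=
      Real.tendsto_sqrt_atTop.comp tendsto_natCast_atTop_atTop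
    simpa using (this.inv_tendsto_atTop).const_mul C
  have hb := (H.mul_const (Real.log 4 + 1)).add hsq
  rw [zero_mul, zero_add] at hb
  refine tendsto_of_tendsto_of_tendsto_of_le_of_le' tendsto_const_nhds hb ?_ ?_
  · exact Eventually.of_forall fun N => div_nonneg
      (Finset.sum_nonneg fun n _ => residueClass_nonneg r n) (Nat.cast_nonneg _)
  · filter_upwards [hcheb', eventually_ge_atTop 2] with N hN hN2
    have hN2' : (2 : ℝ) ≤ N := by exact_mod_cast hN2
    have hN0 : (0 : ℝ) < N := by linarith
    have hlog : 0 < Real.log N := Real.log_pos (by linarith)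
    rw [Nat.floor_natCast] at hN
    rw [hpi]
    have hpos : (0 : ℝ) < Nat.primeCounting N := by
      have : 0 < Nat.primeCounting N :=
        lt_of_lt_of_le (by decide) (Nat.monotone_primeCounting hN2)
      exact_mod_cast this
    have h1 := aux_sum_le r N
    set c : ℝ :=
      (Nat.card ({p : ℕ | p.Prime ∧ (p : ZMod q) = r} ∩ Set.Icc 1 N : Set ℕ) : ℝ) with hc
    have hc0 : 0 ≤ c := Nat.cast_nonneg _
    rw [div_le_iff₀ hN0]
    have h2 : c * Real.log N ≤ c / Nat.primeCounting N * (Real.log 4 + 1) * N := by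
      rw [le_div_iff₀ hlog] at hN
      calc c * Real.log N = c / Nat.primeCounting N * (Nat.primeCounting N * Real.log N) := by
            field_simp
        _ ≤ c / Nat.primeCounting N * ((Real.log 4 + 1) * N) := by gcongr
        _ = _ := by ring
    have h3 : C * (√(N : ℝ))⁻¹ * N = C * √(N : ℝ) := by
      have : 0 < √(N : ℝ) := Real.sqrt_pos.mpr hN0
      nth_rewrite 2 [← Real.mul_self_sqrt hN0.le]
      field_simp
    rw [add_mul, h3]
    linarith [hC N]

/-- Primes in a coprime residue class have positive relative upper density. -/
lemma aux_primes_density {q : ℕ} [NeZero q] {r : ZMod q} (hr : IsUnit r) :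
    0 < Filter.limsup (fun N : ℕ =>
      (Nat.card ({p : ℕ | p.Prime ∧ (p : ZMod q) = r} ∩ Set.Icc 1 N : Set ℕ) : ℝ) /
              (Nat.card {p : ℕ | p.Prime ∧ p ≤ N} : ℝ)) Filter.atTop := by
  by_contra hcon
  push Not at hcon
  apply aux_primes_not_tendsto hr
  have h0 : ∀ N : ℕ, 0 ≤ (fun N : ℕ =>
      (Nat.card ({p : ℕ | p.Prime ∧ (p : ZMod q) = r} ∩ Set.Icc 1 N : Set ℕ) : ℝ) /
              (Nat.card {p : ℕ | p.Prime ∧ p ≤ N} : ℝ)) N := fun N => by positivity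
  have h1 : ∀ N : ℕ, (fun N : ℕ =>
      (Nat.card ({p : ℕ | p.Prime ∧ (p : ZMod q) = r} ∩ Set.Icc 1 N : Set ℕ) : ℝ) /
              (Nat.card {p : ℕ | p.Prime ∧ p ≤ N} : ℝ)) N ≤ 1 := fun N => by
    refine div_le_one_of_le₀ ?_ (Nat.cast_nonneg _)
    norm_cast
    refine Nat.card_mono ((Set.finite_Iic N).subset fun p hp => hp.2) ?_
    intro p hp
    exact ⟨hp.1.1, hp.2.2⟩
  have hbb : IsBoundedUnder (· ≥ ·) atTop (fun N : ℕ =>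
      (Nat.card ({p : ℕ | p.Prime ∧ (p : ZMod q) = r} ∩ Set.Icc 1 N : Set ℕ) : ℝ) /
              (Nat.card {p : ℕ | p.Prime ∧ p ≤ N} : ℝ)) :=
    isBoundedUnder_of ⟨0, h0⟩
  have hba : IsBoundedUnder (· ≤ ·) atTop (fun N : ℕ =>
      (Nat.card ({p : ℕ | p.Prime ∧ (p : ZMod q) = r} ∩ Set.Icc 1 N : Set ℕ) : ℝ) /
              (Nat.card {p : ℕ | p.Prime ∧ p ≤ N} : ℝ)) :=
    isBoundedUnder_of ⟨1, h1⟩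
  refine tendsto_of_le_liminf_of_limsup_le ?_ hcon hba hbb
  exact le_liminf_of_le hba.isCoboundedUnder_ge (Eventually.of_forall h0)

/-- Residue classes have positive upper density. -/
lemma aux_nat_density {m r : ℕ} (hr : 0 < r) (hrm : r < m) :
    0 < Filter.limsup (fun N : ℕ =>
      (Nat.card ({n : ℕ | 0 < n ∧ (n : ZMod m) = r} ∩ Set.Icc 1 N : Set ℕ) : ℝ) / (N : ℝ))
      Filter.atTop := by
  have hm : (0 : ℝ) < m := by exact_mod_cast hr.trans hrm
  refine lt_of_lt_of_le (inv_pos.mpr hm) ?_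
  refine le_limsup_of_frequently_le ?_ ?_
  · rw [frequently_atTop]
    intro N
    refine ⟨m * (N + 1), by nlinarith, ?_⟩
    have hcard : N + 1 ≤
        Nat.card ({n : ℕ | 0 < n ∧ (n : ZMod m) = r} ∩ Set.Icc 1 (m * (N + 1)) : Set ℕ) := by
      have hsub : (((range (N + 1)).image fun j => m * j + r : Finset ℕ) : Set ℕ) ⊆
          ({n : ℕ | 0 < n ∧ (n : ZMod m) = r} ∩ Set.Icc 1 (m * (N + 1)) : Set ℕ) := by
        intro n hn
        simp only [coe_image, Set.mem_image, coe_range, Set.mem_Iio] at hn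
        obtain ⟨j, hj, rfl⟩ := hn
        refine ⟨⟨by omega, by simp⟩, by omega, ?_⟩
        nlinarith
      have := Nat.card_mono ((Set.finite_Icc 1 (m * (N + 1))).subset Set.inter_subset_right) hsub
      rw [Nat.card_coe_set_eq, Set.ncard_coe_finset, Finset.card_image_of_injective,
        card_range] at this
      · exact this
      · intro i j hij
        have : m * i = m * j := by simpa using hij
        exact Nat.eq_of_mul_eq_mul_left (by omega) this
    have hcard' : ((N : ℝ) + 1) ≤
        (Nat.card ({n : ℕ | 0 < n ∧ (n : ZMod m) = r} ∩ Set.Icc 1 (m * (N + 1)) : Set ℕ) : ℝ) := by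
      exact_mod_cast hcard
    have hN : (0 : ℝ) < (N : ℝ) + 1 := by positivity
    rw [le_div_iff₀ (by push_cast; positivity)]
    push_cast
    rw [inv_mul_cancel_left₀ hm.ne']
    exact hcard'
  · refine isBoundedUnder_of ⟨1, fun N => ?_⟩
    refine div_le_one_of_le₀ ?_ (Nat.cast_nonneg _)
    norm_cast
    have := Nat.card_mono (Set.finite_Icc 1 N)
      (Set.inter_subset_right (s := {n : ℕ | 0 < n ∧ (n : ZMod m) = r}))
    simpa using this

lemma aux_congr (s : ℕ) (h : Polynomial ℤ) (a : Fin s → ℤ) (b : ℤ) (m r : ℕ)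
    (x : Fin s → ℕ) (hx : ∀ i, (x i : ZMod m) = r) (hsum : ∑ i, a i * h.eval (x i : ℤ) = b) :
    (m : ℤ) ∣ (∑ i, a i) * h.eval (r : ℤ) - b := by
  rw [← hsum, Finset.sum_mul, ← Finset.sum_sub_distrib]
  refine Finset.dvd_sum fun i _ => ?_
  rw [← mul_sub]
  refine Dvd.dvd.mul_left ?_ _
  refine dvd_trans ?_ (Polynomial.sub_dvd_eval_sub (r : ℤ) (x i : ℤ) h)
  rw [← ZMod.intCast_zmod_eq_zero_iff_dvd]
  simp [hx i]

lemma aux_final (h : Polynomial ℤ) (hdeg : 0 < h.natDegree) (S b : ℤ)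
    (H : ∀ r : ℕ, 0 < r → S * h.eval (r : ℤ) - b = 0) : b = 0 ∧ S = 0 := by
  have hF : Polynomial.C S * h - Polynomial.C b = 0 := by
    refine Polynomial.eq_zero_of_infinite_isRoot _ ?_
    refine Set.Infinite.mono (s := (fun n : ℕ => (n : ℤ)) '' Set.Ioi 0) ?_ ?_
    · rintro _ ⟨n, hn, rfl⟩
      simpa [Polynomial.IsRoot] using H n hn
    · exact (Set.Ioi_infinite 0).image (Nat.cast_injective.injOn)
  have hc := congrArg (fun p => Polynomial.coeff p h.natDegree) hF
  have hh : h ≠ 0 := by rintro rfl; simp at hdeg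
  simp only [Polynomial.coeff_sub, Polynomial.coeff_C_mul, Polynomial.coeff_C, hdeg.ne',
    if_false, sub_zero, Polynomial.coeff_zero] at hc
  have hlc : h.coeff h.natDegree ≠ 0 := Polynomial.leadingCoeff_ne_zero.mpr hh
  replace hc := (mul_eq_zero.mp hc).resolve_right hlc
  have := H 1 one_pos
  rw [hc] at this
  exact ⟨by linarith, hc⟩

theorem necessary_condition_density_regular
    (s : ℕ) (hs : 0 < s) (h : Polynomial ℤ) (hdeg : 0 < h.natDegree)
    (a : Fin s → ℤ) (ha : ∀ i, a i ≠ 0) (b : ℤ)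
    (hDR :
      -- density regular over the positive integers
      (∀ A : Set ℕ, (∀ n ∈ A, 0 < n) →
        0 < Filter.limsup (fun N : ℕ =>
            (Nat.card (A ∩ Set.Icc 1 N : Set ℕ) : ℝ) / (N : ℝ)) Filter.atTop →
        ∃ x : Fin s → ℕ, (∀ i, x i ∈ A) ∧ (∃ i j, x i ≠ x j) ∧
          ∑ i, a i * h.eval (x i : ℤ) = b) ∨
      -- or density regular over the primes
      (∀ A : Set ℕ, (∀ n ∈ A, n.Prime) →
        0 < Filter.limsup (fun N : ℕ =>
            (Nat.card (A ∩ Set.Icc 1 N : Set ℕ) : ℝ) /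
              (Nat.card {p : ℕ | p.Prime ∧ p ≤ N} : ℝ)) Filter.atTop →
        ∃ x : Fin s → ℕ, (∀ i, x i ∈ A) ∧ (∃ i j, x i ≠ x j) ∧
          ∑ i, a i * h.eval (x i : ℤ) = b)) :
    b = 0 ∧ ∑ i, a i = 0 := by
  refine aux_final h hdeg _ b fun r hr => ?_
  -- a large modulus coprime to `r`
  set D : ℤ := (∑ i, a i) * h.eval (r : ℤ) - b with hD
  set m : ℕ := r * (D.natAbs + 1) + 1 with hm
  have hmD : D.natAbs < m := by nlinarith
  have hrm : r < m := Nat.lt_succ_of_le (Nat.le_mul_of_pos_right r (Nat.succ_pos _))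
  have : NeZero m := ⟨by omega⟩
  have key : (m : ℤ) ∣ D := by
    rcases hDR with hDR | hDR
    · obtain ⟨x, hx, -, hsum⟩ := hDR {n : ℕ | 0 < n ∧ (n : ZMod m) = r} (fun n hn => hn.1)
        (aux_nat_density hr hrm)
      exact aux_congr s h a b m r x (fun i => (hx i).2) hsum
    · have hu : IsUnit (r : ZMod m) := by
        rw [ZMod.isUnit_iff_coprime, hm]
        simp
      obtain ⟨x, hx, -, hsum⟩ := hDR {n : ℕ | n.Prime ∧ (n : ZMod m) = r} (fun n hn => hn.1)
        (aux_primes_density hu)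
      exact aux_congr s h a b m r x (fun i => (hx i).2) hsum
  exact Int.eq_zero_of_dvd_of_natAbs_lt_natAbs key (by simpa using hmD)
end
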